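/- Fundamental lemma for logical relations over closed STLC terms: let (Y, ⟦–⟧) be an algebra for the presentation of the STLC with βη-equality, f : X → Y a clone homomorphism, and Q(b) ⊆ Y(⋄;b) a subset of closed terms of base type. Extend Q to all types by Q(A ⇒ B) = { t ∈ Y(⋄; A⇒B) | ∀ a ∈ Q(A), ⟦app⟧_⋄(t, a) ∈ Q(B) }. If f_{Γ;B}(t) ∈ Q*(Γ;B) for every t ∈ X(Γ;B) (where Q*(Γ;B) = { t | ∀ σ with σ_j ∈ Q(Γ_j), t[σ] ∈ Q(B) }), then f̂_{⋄;A}(t) ∈ Q(A) for every closed free term t ∈ (F X)(⋄;A) of the free algebra on X. -/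

import Mathlib

/-- Data of an `S`-sorted abstract clone: term sets, variables, substitution. -/
structure CloneData (S : Type) : Type 1 where
  T : List S → S → Type
  varC : (Γ : List S) → (i : Fin Γ.length) → T Γ (Γ.get i)
  substC : {Γ Δ : List S} → {A : S} → T Δ A → ((i : Fin Δ.length) → T Γ (Δ.get i)) → T Γ A

namespace CloneData

variable {S : Type}

/-- Substitutions `σ ∈ X(Γ;Δ)`. -/
abbrev Sub (X : CloneData S) (Γ Δ : List S) : Type := (i : Fin Δ.length) → X.T Γ (Δ.get i)

def castT (X : CloneData S) {Γ : List S} {A B : S} (h : A = B) (t : X.T Γ A) : X.T Γ B := h ▸ t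

def castCtx (X : CloneData S) {Γ Γ' : List S} {A : S} (h : Γ = Γ') (t : X.T Γ A) : X.T Γ' A :=
  h ▸ t

end CloneData

/-- The three clone laws. -/
def IsClone {S : Type} (X : CloneData S) : Prop :=
  (∀ (Γ Δ : List S) (i : Fin Δ.length) (σ : X.Sub Γ Δ), X.substC (X.varC Δ i) σ = σ i) ∧
  (∀ (Γ : List S) (A : S) (t : X.T Γ A), X.substC t (X.varC Γ) = t) ∧
  (∀ (Γ Δ Ξ : List S) (A : S) (t : X.T Ξ A) (σ' : X.Sub Δ Ξ) (σ : X.Sub Γ Δ),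
    X.substC t (fun i => X.substC (σ' i) σ) = X.substC (X.substC t σ') σ)

/-- Clone homomorphisms: families of maps preserving variables and substitution. -/
def IsCloneHom {S : Type} (X Y : CloneData S) (f : ∀ (Γ : List S) (A : S), X.T Γ A → Y.T Γ A) :
    Prop :=
  (∀ (Γ : List S) (i : Fin Γ.length), f Γ (Γ.get i) (X.varC Γ i) = Y.varC Γ i) ∧
  (∀ (Γ Δ : List S) (A : S) (t : X.T Δ A) (σ : X.Sub Γ Δ),
    f Γ A (X.substC t σ) = Y.substC (f Δ A t) (fun i => f Γ (Δ.get i) (σ i)))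
namespace CloneAux

theorem get_append_left {α : Type} (Γ Ξ : List α) {j : ℕ} (h : j < Γ.length)
    (h2 : j < (Γ ++ Ξ).length) : (Γ ++ Ξ).get ⟨j, h2⟩ = Γ.get ⟨j, h⟩ := by
  simp [List.get_eq_getElem, List.getElem_append_left, h]

theorem get_append_right {α : Type} (Γ Ξ : List α) {j : ℕ} (h : ¬ j < Γ.length)
    (h2 : j < (Γ ++ Ξ).length) (h3 : j - Γ.length < Ξ.length) :
    (Γ ++ Ξ).get ⟨j, h2⟩ = Ξ.get ⟨j - Γ.length, h3⟩ := by
  simp only [List.get_eq_getElem]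
  rw [List.getElem_append_right (by omega)]

theorem sub_lt_of_append {α : Type} {Γ Ξ : List α} {j : ℕ} (h : ¬ j < Γ.length)
    (h2 : j < (Γ ++ Ξ).length) : j - Γ.length < Ξ.length := by
  simp only [List.length_append] at h2; omega

theorem add_lt_append {α : Type} (Γ Ξ : List α) {j : ℕ} (h : j < Ξ.length) :
    Γ.length + j < (Γ ++ Ξ).length := by
  simp only [List.length_append]; omega

theorem get_append_add {α : Type} (Γ Ξ : List α) {j : ℕ} (h : j < Ξ.length)
    (h2 : Γ.length + j < (Γ ++ Ξ).length) :
    (Γ ++ Ξ).get ⟨Γ.length + j, h2⟩ = Ξ.get ⟨j, h⟩ := by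
  simp only [List.get_eq_getElem]
  rw [List.getElem_append_right (by omega)]
  congr 1; omega

theorem le_append_length {α : Type} (Γ Ξ : List α) : Γ.length ≤ (Γ ++ Ξ).length := by
  simp [List.length_append]

end CloneAux
namespace CloneData

variable {S : Type}

/-- The weakening substitution `▷ wk^Γ_Ξ ∈ X(Γ,Ξ;Γ)`: the first `|Γ|` variables of `Γ ++ Ξ`. -/
def wkVar (X : CloneData S) (Γ Ξ : List S) : X.Sub (Γ ++ Ξ) Γ := fun i =>
  X.castT (CloneAux.get_append_left Γ Ξ i.isLt _)
    (X.varC (Γ ++ Ξ) ⟨(i : ℕ), lt_of_lt_of_le i.isLt (CloneAux.le_append_length Γ Ξ)⟩)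

/-- Extend a substitution `σ ∈ X(Γ,Ξ;Δ)` to `X(Γ,Ξ;Δ,Ξ)`, sending the extra variables of `Ξ`
to the corresponding variables of `Γ,Ξ`. -/
def extSub (X : CloneData S) (Ξ Γ Δ : List S)
    (σ : (i : Fin Δ.length) → X.T (Γ ++ Ξ) (Δ.get i)) : X.Sub (Γ ++ Ξ) (Δ ++ Ξ) := fun j =>
  if h : (j : ℕ) < Δ.length then
    X.castT (CloneAux.get_append_left Δ Ξ h j.isLt).symm (σ ⟨(j : ℕ), h⟩)
  else
    X.castT
      ((CloneAux.get_append_add Γ Ξ (CloneAux.sub_lt_of_append h j.isLt) _).trans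
        (CloneAux.get_append_right Δ Ξ h j.isLt (CloneAux.sub_lt_of_append h j.isLt)).symm)
      (X.varC (Γ ++ Ξ)
        ⟨Γ.length + ((j : ℕ) - Δ.length),
          CloneAux.add_lt_append Γ Ξ (CloneAux.sub_lt_of_append h j.isLt)⟩)

/-- The context extension `⟨Ξ⟩X`, with `(⟨Ξ⟩X)(Γ;A) = X(Γ,Ξ;A)`. -/
def ext (X : CloneData S) (Ξ : List S) : CloneData S where
  T Γ A := X.T (Γ ++ Ξ) A
  varC Γ i := X.wkVar Γ Ξ i
  substC {Γ Δ A} t σ := X.substC t (X.extSub Ξ Γ Δ σ)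

/-- The weakening map `wk^Ξ_X : X → ⟨Ξ⟩X`, sending `t` to `t[▷wk^Γ_Ξ]`. -/
def wkHom (X : CloneData S) (Ξ : List S) (Γ : List S) (A : S) (t : X.T Γ A) :
    (X.ext Ξ).T Γ A :=
  X.substC t (X.wkVar Γ Ξ)

end CloneData
namespace CloneData

/-- Lift a substitution `σ ∈ Y(Ξ;Γ)` to `σ↑Δ ∈ Y(Ξ,Δ;Γ,Δ)`: weaken the terms of `σ` and send
the extra variables of `Δ` to the corresponding variables of `Ξ,Δ`. -/
def liftSub {S : Type} (Y : CloneData S) {Ξ Γ : List S} (σ : Y.Sub Ξ Γ) (Δ : List S) :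
    Y.Sub (Ξ ++ Δ) (Γ ++ Δ) := fun j =>
  if h : (j : ℕ) < Γ.length then
    Y.castT (CloneAux.get_append_left Γ Δ h j.isLt).symm
      (Y.substC (σ ⟨(j : ℕ), h⟩) (Y.wkVar Ξ Δ))
  else
    Y.castT
      ((CloneAux.get_append_add Ξ Δ (CloneAux.sub_lt_of_append h j.isLt) _).trans
        (CloneAux.get_append_right Γ Δ h j.isLt (CloneAux.sub_lt_of_append h j.isLt)).symm)
      (Y.varC (Ξ ++ Δ)
        ⟨Ξ.length + ((j : ℕ) - Γ.length),
          CloneAux.add_lt_append Ξ Δ (CloneAux.sub_lt_of_append h j.isLt)⟩)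

end CloneData
namespace CloneData

/-- The substitution `(σ, u) ∈ Y(Ξ; Γ,A)` extending `σ ∈ Y(Ξ;Γ)` by a term `u ∈ Y(Ξ;A)`. -/
def snocSub {S : Type} (Y : CloneData S) {Ξ Γ : List S} {A : S} (σ : Y.Sub Ξ Γ) (u : Y.T Ξ A) :
    Y.Sub Ξ (Γ ++ [A]) := fun j =>
  if h : (j : ℕ) < Γ.length then
    Y.castT (CloneAux.get_append_left Γ [A] h j.isLt).symm (σ ⟨(j : ℕ), h⟩)
  else
    Y.castT
      (by
        have h3 := CloneAux.sub_lt_of_append h j.isLt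
        have := CloneAux.get_append_right Γ [A] h j.isLt h3
        rw [this]
        have : (j : ℕ) - Γ.length = 0 := by simp at h3; omega
        simp [this])
      u

/-- The last variable `var_{n+1} ∈ Y(Γ,A;A)` of the extended context `Γ,A`. -/
def lastVar {S : Type} (Y : CloneData S) (Γ : List S) (A : S) : Y.T (Γ ++ [A]) A :=
  Y.castT
    (by
      have h2 : Γ.length < (Γ ++ [A]).length := by simp
      have := CloneAux.get_append_right Γ [A] (lt_irrefl Γ.length) h2 (by simp)
      rw [this]; simp)
    (Y.varC (Γ ++ [A]) ⟨Γ.length, by simp⟩)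

end CloneData
/-- Simple types: freely generated by a base type and function types. -/
inductive Ty : Type
  | base : Ty
  | arrow : Ty → Ty → Ty
/-- The data of an algebra for the presentation of the STLC: a `Ty`-sorted clone together
with interpretations of the application and abstraction operators. -/
structure STLCAlgData : Type 1 where
  C : CloneData Ty
  app : ∀ (Γ : List Ty) (A B : Ty), C.T Γ (Ty.arrow A B) → C.T Γ A → C.T Γ B
  abs : ∀ (Γ : List Ty) (A B : Ty), C.T (Γ ++ [A]) B → C.T Γ (Ty.arrow A B)

/-- The laws of an algebra for the presentation of the STLC with βη-equality: the clone laws,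
commutation of `app` and `abs` with substitution, and the β- and η-laws. -/
def IsSTLCAlg (M : STLCAlgData) : Prop :=
  IsClone M.C ∧
  (∀ (Γ Ξ : List Ty) (A B : Ty) (t : M.C.T Γ (Ty.arrow A B)) (u : M.C.T Γ A)
      (σ : M.C.Sub Ξ Γ),
    M.C.substC (M.app Γ A B t u) σ = M.app Ξ A B (M.C.substC t σ) (M.C.substC u σ)) ∧
  (∀ (Γ Ξ : List Ty) (A B : Ty) (t : M.C.T (Γ ++ [A]) B) (σ : M.C.Sub Ξ Γ),
    M.C.substC (M.abs Γ A B t) σ = M.abs Ξ A B (M.C.substC t (M.C.liftSub σ [A]))) ∧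
  (∀ (Γ : List Ty) (A B : Ty) (t : M.C.T (Γ ++ [A]) B) (u : M.C.T Γ A),
    M.app Γ A B (M.abs Γ A B t) u = M.C.substC t (M.C.snocSub (M.C.varC Γ) u)) ∧
  (∀ (Γ : List Ty) (A B : Ty) (t : M.C.T Γ (Ty.arrow A B)),
    M.abs Γ A B
        (M.app (Γ ++ [A]) A B (M.C.substC t (M.C.wkVar Γ [A])) (M.C.lastVar Γ A)) = t)

/-- Homomorphisms of STLC algebras: clone homomorphisms preserving `app` and `abs`. -/
def IsSTLCHom (M N : STLCAlgData) (g : ∀ (Γ : List Ty) (A : Ty), M.C.T Γ A → N.C.T Γ A) :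
    Prop :=
  IsCloneHom M.C N.C g ∧
  (∀ (Γ : List Ty) (A B : Ty) (t : M.C.T Γ (Ty.arrow A B)) (u : M.C.T Γ A),
    g Γ B (M.app Γ A B t u) = N.app Γ A B (g Γ (Ty.arrow A B) t) (g Γ A u)) ∧
  (∀ (Γ : List Ty) (A B : Ty) (t : M.C.T (Γ ++ [A]) B),
    g Γ (Ty.arrow A B) (M.abs Γ A B t) = N.abs Γ A B (g (Γ ++ [A]) B t))

/-- `F` together with `η : X → F` is the free STLC βη-algebra on the clone `X`. -/
def IsFreeSTLCAlg (X : CloneData Ty) (F : STLCAlgData)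
    (η : ∀ (Γ : List Ty) (A : Ty), X.T Γ A → F.C.T Γ A) : Prop :=
  IsSTLCAlg F ∧ IsCloneHom X F.C η ∧
  ∀ N : STLCAlgData, IsSTLCAlg N →
    ∀ f : ∀ (Γ : List Ty) (A : Ty), X.T Γ A → N.C.T Γ A, IsCloneHom X N.C f →
      ∃! g : ∀ (Γ : List Ty) (A : Ty), F.C.T Γ A → N.C.T Γ A,
        IsSTLCHom F N g ∧ ∀ Γ A t, g Γ A (η Γ A t) = f Γ A t

/-- The logical relation on closed terms determined by a subset at base type:
`Q(A ⇒ B) = { t | ∀ a ∈ Q(A), ⟦app⟧(t,a) ∈ Q(B) }`. -/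
def LRc (Y : STLCAlgData) (Q0 : Set (Y.C.T [] Ty.base)) : (A : Ty) → Set (Y.C.T [] A)
  | Ty.base => Q0
  | Ty.arrow A B => {t | ∀ a ∈ LRc Y Q0 A, Y.app [] A B t a ∈ LRc Y Q0 B}

namespace CloneData

variable {S : Type}

theorem map_castT {X Y : CloneData S} (f : ∀ (Γ : List S) (A : S), X.T Γ A → Y.T Γ A)
    {Γ : List S} {A B : S} (h : A = B) (t : X.T Γ A) :
    f Γ B (X.castT h t) = Y.castT h (f Γ A t) := by
  subst h; rfl

theorem substC_castT (X : CloneData S) {Γ Δ : List S} {A B : S} (h : A = B) (t : X.T Δ A)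
    (σ : X.Sub Γ Δ) : X.substC (X.castT h t) σ = X.castT h (X.substC t σ) := by
  subst h; rfl

theorem castT_castT (X : CloneData S) {Γ : List S} {A B C : S} (h : A = B) (h' : B = C)
    (t : X.T Γ A) : X.castT h' (X.castT h t) = X.castT (h.trans h') t := by
  subst h; subst h'; rfl

theorem snocSub_of_lt (X : CloneData S) {Ξ Γ : List S} {A : S} (σ : X.Sub Ξ Γ) (u : X.T Ξ A)
    (j : Fin (Γ ++ [A]).length) (h : (j : ℕ) < Γ.length) :
    X.snocSub σ u j =
      X.castT (CloneAux.get_append_left Γ [A] h j.isLt).symm (σ ⟨(j : ℕ), h⟩) :=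
  dif_pos h

theorem snocSub_of_not_lt (X : CloneData S) {Ξ Γ : List S} {A : S} (σ : X.Sub Ξ Γ) (u : X.T Ξ A)
    (j : Fin (Γ ++ [A]).length) (h : ¬ (j : ℕ) < Γ.length) (e : A = (Γ ++ [A]).get j) :
    X.snocSub σ u j = X.castT e u :=
  dif_neg h

theorem map_snocSub {X Y : CloneData S}
    (f : ∀ (Γ : List S) (A : S), X.T Γ A → Y.T Γ A) {Ξ Γ : List S} {A : S}
    (σ : X.Sub Ξ Γ) (u : X.T Ξ A) (j : Fin (Γ ++ [A]).length) :
    f Ξ ((Γ ++ [A]).get j) (X.snocSub σ u j) =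
      Y.snocSub (fun i => f Ξ (Γ.get i) (σ i)) (f Ξ A u) j := by
  by_cases h : (j : ℕ) < Γ.length
  · rw [snocSub, snocSub, dif_pos h, dif_pos h, map_castT f]
  · rw [snocSub, snocSub, dif_neg h, dif_neg h, map_castT f]

theorem get_append_singleton_of_not_lt {Γ : List S} {A : S} (j : Fin (Γ ++ [A]).length)
    (h : ¬ (j : ℕ) < Γ.length) : A = (Γ ++ [A]).get j := by
  rw [CloneAux.get_append_right Γ [A] h j.isLt (CloneAux.sub_lt_of_append h j.isLt)]
  simp

/-- Substitution along the weakening of `Γ` discards the last term of `(σ, u)`. -/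
theorem wkVar_snocSub {X : CloneData S} (hX : IsClone X) {Ξ Γ : List S} {A : S}
    (σ : X.Sub Ξ Γ) (u : X.T Ξ A) (i : Fin Γ.length) :
    X.substC (X.wkVar Γ [A] i) (X.snocSub σ u) = σ i := by
  rw [wkVar, substC_castT, hX.1, snocSub_of_lt X σ u _ i.isLt, castT_castT]
  rfl

/-- Lifting `σ` and then instantiating the last variable by `u` gives `(σ, u)`. -/
theorem liftSub_snocSub {X : CloneData S} (hX : IsClone X) {Ξ Γ : List S} {A : S}
    (σ : X.Sub Ξ Γ) (u : X.T Ξ A) (j : Fin (Γ ++ [A]).length) :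
    X.substC (X.liftSub σ [A] j) (X.snocSub (X.varC Ξ) u) = X.snocSub σ u j := by
  by_cases h : (j : ℕ) < Γ.length
  · rw [snocSub_of_lt X σ u j h, liftSub, dif_pos h, substC_castT, ← hX.2.2]
    simp only [wkVar_snocSub hX, hX.2.1]
  · rw [snocSub_of_not_lt X σ u j h (get_append_singleton_of_not_lt j h), liftSub, dif_neg h,
      substC_castT, hX.1,
      snocSub_of_not_lt X _ u _ (by simp) (get_append_singleton_of_not_lt _ (by simp)),
      castT_castT]

/-- The sub-clone data carved out by a family of subsets closed under variables and
substitution. -/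
def restrict (Y : CloneData S) (P : ∀ (Γ : List S) (A : S), Set (Y.T Γ A))
    (hvar : ∀ Γ i, Y.varC Γ i ∈ P Γ (Γ.get i))
    (hsubst : ∀ {Γ Δ : List S} {A : S} (t : Y.T Δ A) (σ : Y.Sub Γ Δ), t ∈ P Δ A →
      (∀ i, σ i ∈ P Γ (Δ.get i)) → Y.substC t σ ∈ P Γ A) : CloneData S where
  T Γ A := P Γ A
  varC Γ i := ⟨Y.varC Γ i, hvar Γ i⟩
  substC t σ := ⟨Y.substC t.1 (fun i => (σ i).1), hsubst _ _ t.2 fun i => (σ i).2⟩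

end CloneData

namespace IsCloneHom

variable {S : Type} {X Y : CloneData S} {f : ∀ (Γ : List S) (A : S), X.T Γ A → Y.T Γ A}

theorem map_wkVar (hf : IsCloneHom X Y f) (Γ Ξ : List S) (i : Fin Γ.length) :
    f (Γ ++ Ξ) (Γ.get i) (X.wkVar Γ Ξ i) = Y.wkVar Γ Ξ i := by
  rw [CloneData.wkVar, CloneData.map_castT f, hf.1]
  rfl

theorem map_lastVar (hf : IsCloneHom X Y f) (Γ : List S) (A : S) :
    f (Γ ++ [A]) A (X.lastVar Γ A) = Y.lastVar Γ A := by
  rw [CloneData.lastVar, CloneData.map_castT f, hf.1]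
  rfl

theorem map_liftSub (hf : IsCloneHom X Y f) {Ξ Γ : List S} (σ : X.Sub Ξ Γ) (Δ : List S)
    (j : Fin (Γ ++ Δ).length) :
    f (Ξ ++ Δ) ((Γ ++ Δ).get j) (X.liftSub σ Δ j) =
      Y.liftSub (fun i => f Ξ (Γ.get i) (σ i)) Δ j := by
  by_cases h : (j : ℕ) < Γ.length
  · rw [CloneData.liftSub, CloneData.liftSub, dif_pos h, dif_pos h, CloneData.map_castT f, hf.2]
    simp only [hf.map_wkVar]
  · rw [CloneData.liftSub, CloneData.liftSub, dif_neg h, dif_neg h, CloneData.map_castT f, hf.1]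

/-- The clone laws are reflected along injective homomorphisms. -/
theorem isClone_of_injective (hf : IsCloneHom X Y f) (hinj : ∀ Γ A, Function.Injective (f Γ A))
    (hY : IsClone Y) : IsClone X := by
  refine ⟨fun Γ Δ i σ => hinj _ _ ?_, fun Γ A t => hinj _ _ ?_,
    fun Γ Δ Ξ A t σ' σ => hinj _ _ ?_⟩
  · rw [hf.2, hf.1, hY.1]
  · rw [hf.2]
    simp only [hf.1, hY.2.1]
  · simp only [hf.2, hY.2.2]

end IsCloneHom

/-- The laws of an STLC algebra are reflected along injective homomorphisms. -/
theorem IsSTLCHom.isSTLCAlg_of_injective {M N : STLCAlgData}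
    {g : ∀ (Γ : List Ty) (A : Ty), M.C.T Γ A → N.C.T Γ A} (hg : IsSTLCHom M N g)
    (hinj : ∀ Γ A, Function.Injective (g Γ A)) (hN : IsSTLCAlg N) : IsSTLCAlg M := by
  obtain ⟨hc, happ, habs⟩ := hg
  obtain ⟨hNc, hNapp, hNabs, hNβ, hNη⟩ := hN
  refine ⟨hc.isClone_of_injective hinj hNc, fun Γ Ξ A B t u σ => hinj _ _ ?_,
    fun Γ Ξ A B t σ => hinj _ _ ?_, fun Γ A B t u => hinj _ _ ?_, fun Γ A B t => hinj _ _ ?_⟩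
  · simp only [hc.2, happ, hNapp]
  · simp only [hc.2, habs, hNabs, hc.map_liftSub]
  · simp only [hc.2, happ, habs, hNβ, CloneData.map_snocSub g, hc.1]
  · simp only [hc.2, happ, habs, hc.map_wkVar, hc.map_lastVar, hNη]

theorem IsSTLCHom.comp {L M N : STLCAlgData}
    {h : ∀ (Γ : List Ty) (A : Ty), M.C.T Γ A → N.C.T Γ A}
    {g : ∀ (Γ : List Ty) (A : Ty), L.C.T Γ A → M.C.T Γ A}
    (hh : IsSTLCHom M N h) (hg : IsSTLCHom L M g) :
    IsSTLCHom L N (fun Γ A t => h Γ A (g Γ A t)) := by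
  refine ⟨⟨fun Γ i => ?_, fun Γ Δ A t σ => ?_⟩, fun Γ A B t u => ?_, fun Γ A B t => ?_⟩
  · simp only [hg.1.1, hh.1.1]
  · simp only [hg.1.2, hh.1.2]
  · simp only [hg.2.1, hh.2.1]
  · simp only [hg.2.2, hh.2.2]

/-- The open extension `Q*` of the logical relation `Q` on closed terms. -/
def LRo (Y : STLCAlgData) (Q0 : Set (Y.C.T [] Ty.base)) (Γ : List Ty) (A : Ty) :
    Set (Y.C.T Γ A) :=
  {t | ∀ σ : Y.C.Sub [] Γ, (∀ j, σ j ∈ LRc Y Q0 (Γ.get j)) → Y.C.substC t σ ∈ LRc Y Q0 A}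

section LRo

variable {Y : STLCAlgData} (Q0 : Set (Y.C.T [] Ty.base))

theorem LRc.castT_mem {A B : Ty} (h : A = B) {t : Y.C.T [] A} (ht : t ∈ LRc Y Q0 A) :
    Y.C.castT h t ∈ LRc Y Q0 B := by
  subst h; exact ht

theorem LRc.snocSub_mem {Γ : List Ty} {A : Ty} {σ : Y.C.Sub [] Γ} {u : Y.C.T [] A}
    (hσ : ∀ j, σ j ∈ LRc Y Q0 (Γ.get j)) (hu : u ∈ LRc Y Q0 A) (j : Fin (Γ ++ [A]).length) :
    Y.C.snocSub σ u j ∈ LRc Y Q0 ((Γ ++ [A]).get j) := by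
  by_cases h : (j : ℕ) < Γ.length
  · rw [CloneData.snocSub, dif_pos h]
    exact castT_mem Q0 _ (hσ _)
  · rw [CloneData.snocSub, dif_neg h]
    exact castT_mem Q0 _ hu

theorem LRo.varC_mem (hY : IsSTLCAlg Y) (Γ : List Ty) (i : Fin Γ.length) :
    Y.C.varC Γ i ∈ LRo Y Q0 Γ (Γ.get i) := by
  intro σ hσ
  rw [hY.1.1]
  exact hσ i

theorem LRo.substC_mem (hY : IsSTLCAlg Y) {Γ Δ : List Ty} {A : Ty} (t : Y.C.T Δ A)
    (σ : Y.C.Sub Γ Δ) (ht : t ∈ LRo Y Q0 Δ A) (hσ : ∀ i, σ i ∈ LRo Y Q0 Γ (Δ.get i)) :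
    Y.C.substC t σ ∈ LRo Y Q0 Γ A := by
  intro τ hτ
  rw [← hY.1.2.2]
  exact ht _ fun j => hσ j τ hτ

theorem LRo.app_mem (hY : IsSTLCAlg Y) {Γ : List Ty} {A B : Ty}
    {t : Y.C.T Γ (Ty.arrow A B)} {u : Y.C.T Γ A}
    (ht : t ∈ LRo Y Q0 Γ (Ty.arrow A B)) (hu : u ∈ LRo Y Q0 Γ A) :
    Y.app Γ A B t u ∈ LRo Y Q0 Γ B := by
  intro σ hσ
  rw [hY.2.1]
  exact ht σ hσ _ (hu σ hσ)

theorem LRo.abs_mem (hY : IsSTLCAlg Y) {Γ : List Ty} {A B : Ty} {t : Y.C.T (Γ ++ [A]) B}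
    (ht : t ∈ LRo Y Q0 (Γ ++ [A]) B) : Y.abs Γ A B t ∈ LRo Y Q0 Γ (Ty.arrow A B) := by
  intro σ hσ a ha
  rw [hY.2.2.1, hY.2.2.2.1, ← hY.1.2.2]
  simp only [CloneData.liftSub_snocSub hY.1]
  exact ht _ (LRc.snocSub_mem Q0 hσ ha)

theorem LRo.mem_LRc_of_closed (hY : IsSTLCAlg Y) {A : Ty} {t : Y.C.T [] A} (ht : t ∈ LRo Y Q0 [] A) :
    t ∈ LRc Y Q0 A := by
  rw [← hY.1.2.1 [] A t]
  exact ht _ fun j => j.elim0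

/-- The subalgebra of `Y` consisting of the terms that satisfy `Q*`. -/
def LRo.subalg (hY : IsSTLCAlg Y) : STLCAlgData where
  C := Y.C.restrict (LRo Y Q0) (varC_mem Q0 hY) (substC_mem Q0 hY)
  app Γ A B t u := ⟨Y.app Γ A B t.1 u.1, app_mem Q0 hY t.2 u.2⟩
  abs Γ A B t := ⟨Y.abs Γ A B t.1, abs_mem Q0 hY t.2⟩

theorem LRo.isSTLCHom_val (hY : IsSTLCAlg Y) :
    IsSTLCHom (subalg Q0 hY) Y (fun _ _ t => t.1) :=
  ⟨⟨fun _ _ => rfl, fun _ _ _ _ _ => rfl⟩, fun _ _ _ _ _ => rfl, fun _ _ _ _ => rfl⟩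

theorem LRo.isSTLCAlg_subalg (hY : IsSTLCAlg Y) : IsSTLCAlg (subalg Q0 hY) :=
  (isSTLCHom_val Q0 hY).isSTLCAlg_of_injective (fun _ _ => Subtype.val_injective) hY

end LRo

/-- Fundamental lemma for logical relations over closed STLC terms: if a clone homomorphism
`f : X → Y` into an STLC βη-algebra lands in `Q*`, then the extension `f̂` of `f` to the free
algebra on `X` maps every closed term into the logical relation `Q`. -/
theorem logical_relations_closed (Y : STLCAlgData) (hY : IsSTLCAlg Y)
    (X : CloneData Ty) (hX : IsClone X)
    (f : ∀ (Γ : List Ty) (A : Ty), X.T Γ A → Y.C.T Γ A) (hf : IsCloneHom X Y.C f)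
    (Q0 : Set (Y.C.T [] Ty.base))
    (F : STLCAlgData) (η : ∀ (Γ : List Ty) (A : Ty), X.T Γ A → F.C.T Γ A)
    (hF : IsFreeSTLCAlg X F η)
    (g : ∀ (Γ : List Ty) (A : Ty), F.C.T Γ A → Y.C.T Γ A)
    (hg : IsSTLCHom F Y g) (hgη : ∀ Γ A t, g Γ A (η Γ A t) = f Γ A t)
    (hfQ : ∀ (Γ : List Ty) (B : Ty) (t : X.T Γ B) (σ : Y.C.Sub [] Γ),
      (∀ j, σ j ∈ LRc Y Q0 (Γ.get j)) → Y.C.substC (f Γ B t) σ ∈ LRc Y Q0 B) :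
    ∀ (A : Ty) (t : F.C.T [] A), g [] A t ∈ LRc Y Q0 A := by
  obtain ⟨-, -, hfree⟩ := hF
  have hfN : IsCloneHom X (LRo.subalg Q0 hY).C fun Γ A t => ⟨f Γ A t, hfQ Γ A t⟩ :=
    ⟨fun Γ i => Subtype.ext (hf.1 Γ i), fun Γ Δ A t σ => Subtype.ext (hf.2 Γ Δ A t σ)⟩
  obtain ⟨k, ⟨hk, hkη⟩, -⟩ := hfree _ (LRo.isSTLCAlg_subalg Q0 hY) _ hfN
  have hgk : g = fun Γ A t => (k Γ A t).1 :=
    (hfree Y hY f hf).unique ⟨hg, hgη⟩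
      ⟨(LRo.isSTLCHom_val Q0 hY).comp hk, fun Γ A t => congrArg Subtype.val (hkη Γ A t)⟩
  intro A t
  rw [hgk]
  exact LRo.mem_LRc_of_closed Q0 hY (k [] A t).2
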